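/- arXiv:2207.00752 — 5 statements merged into one kernel-verified Lean document; each statement's English description precedes it below -/
import Mathlib

section
/- Fix x ∈ ℝ², t ∈ ℝ, Δt > 0. Let v : ℝ² → ℝ² be differentiable at x with Jacobian matrix Dv(x) ∈ ℝ^{2×2}, and write γ(s) := det(I₂ − s·Dv(x)). Let φ : ℝ² × ℝ → ℝ be differentiable at (x,t), and suppose the function g(s) := φ(x − s·v(x), t − s)·γ(s) is twice differentiable on [0, Δt] with |g''(s)| ≤ M for all s ∈ [0, Δt]. Then | (φ(x,t) − φ(x − Δt·v(x), t − Δt)·det(I₂ − Δt·Dv(x)))/Δt − (∂φ/∂t(x,t) + v(x)·∇φ(x,t) + φ(x,t)·div v(x)) | ≤ (M/2)·Δt; i.e., the one-step Jacobian-weighted characteristic discretization of the conservative material derivative ∂φ/∂t + ∇·(vφ) is first-order accurate in time. -/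
open Set

/-- First-order Taylor estimate on `[0, b]` with one-sided derivatives at the end points; the second
derivative is only assumed to exist and to be bounded. -/
theorem norm_sub_sub_smul_le_of_hasDerivWithinAt {E : Type*} [NormedAddCommGroup E]
    [NormedSpace ℝ E] {f f' f'' : ℝ → E} {b M : ℝ} (hb : 0 ≤ b)
    (hf : ∀ s ∈ Icc 0 b, HasDerivWithinAt f (f' s) (Icc 0 b) s)
    (hf' : ∀ s ∈ Icc 0 b, HasDerivWithinAt f' (f'' s) (Icc 0 b) s)
    (hM : ∀ s ∈ Icc 0 b, ‖f'' s‖ ≤ M) :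
    ‖f b - f 0 - b • f' 0‖ ≤ M / 2 * b ^ 2 := by
  have bound : ∀ s ∈ Icc 0 b, ‖f' s - f' 0‖ ≤ M * s := fun s hs => by
    simpa [abs_of_nonneg hs.1] using
      (convex_Icc 0 b).norm_image_sub_le_of_norm_hasDerivWithin_le hf' hM
        (left_mem_Icc.2 hb) hs
  have deriv_remainder : ∀ s ∈ Icc 0 b,
      HasDerivWithinAt (fun s => f s - f 0 - s • f' 0) (f' s - f' 0) (Icc 0 b) s := fun s hs =>
    (((hf s hs).sub_const (f 0)).sub
      ((hasDerivWithinAt_id s (Icc 0 b)).smul_const (f' 0))).congr_deriv (by simp)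
  have deriv_bound : ∀ s, HasDerivAt (fun s : ℝ => M / 2 * s ^ 2) (M * s) s := fun s =>
    ((hasDerivAt_pow 2 s).const_mul (M / 2)).congr_deriv (by norm_num; ring)
  refine image_norm_le_of_norm_deriv_right_le_deriv_boundary
    (f := fun s => f s - f 0 - s • f' 0) (f' := fun s => f' s - f' 0)
    (fun s hs => (deriv_remainder s hs).continuousWithinAt)
    (fun s hs => ?_) (by simp) deriv_bound
    (fun s hs => bound s (Ico_subset_Icc_self hs)) (right_mem_Icc.2 hb)
  exact (deriv_remainder s (Ico_subset_Icc_self hs)).mono_of_mem_nhdsWithin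
    (Icc_mem_nhdsGE_of_mem hs)

/-- The derivative of `s ↦ det (1 - s A)` at `0` is `-tr A`. -/
theorem LinearMap.hasDerivAt_det_id_sub_smul {E : Type*} [AddCommGroup E] [Module ℝ E]
    [Module.Finite ℝ E] (A : E →ₗ[ℝ] E) :
    HasDerivAt (fun s : ℝ => LinearMap.det (LinearMap.id - s • A))
      (-LinearMap.trace ℝ E A) 0 := by
  let β := Module.finBasis ℝ E
  set B := LinearMap.toMatrix β β A with hB
  have det_eq : (fun s : ℝ => LinearMap.det (LinearMap.id - s • A)) =
      fun s => 1 + B.trace * (-s) +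
        (Matrix.det (1 + (Polynomial.X : Polynomial ℝ) • B.map Polynomial.C)).divX.divX.eval (-s) *
          (-s) ^ 2 := by
    funext s
    rw [← Matrix.det_one_add_smul, ← LinearMap.det_toMatrix β, map_sub, map_smul,
      LinearMap.toMatrix_id, neg_smul, sub_eq_add_neg]
  rw [det_eq, LinearMap.trace_eq_matrix_trace ℝ β, ← hB]
  set p := (Matrix.det (1 + (Polynomial.X : Polynomial ℝ) • B.map Polynomial.C)).divX.divX
  have hneg := hasDerivAt_neg (0 : ℝ)
  have hp : HasDerivAt (fun s : ℝ => p.eval (-s)) _ 0 :=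
    (p.hasDerivAt (-0)).comp (0 : ℝ) hneg
  exact (((hneg.const_mul B.trace).const_add 1).add (hp.mul (hneg.pow 2))).congr_deriv (by simp)

/-- The one-step Jacobian-weighted characteristic discretization of the conservative
material derivative `∂φ/∂t + ∇·(vφ) = ∂φ/∂t + v·∇φ + φ div v` is first-order accurate
in time. Here `γ s = det (I₂ - s • Dv(x))` is the Jacobian determinant of the upwind
mapping, and `div v(x) = tr (Dv(x))`. -/
theorem stmt_1
    (x : EuclideanSpace ℝ (Fin 2)) (t : ℝ) (Δt : ℝ) (hΔt : 0 < Δt)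
    (v : EuclideanSpace ℝ (Fin 2) → EuclideanSpace ℝ (Fin 2))
    (hv : DifferentiableAt ℝ v x)
    (φ : EuclideanSpace ℝ (Fin 2) × ℝ → ℝ)
    (hφ : DifferentiableAt ℝ φ (x, t))
    (γ : ℝ → ℝ)
    (hγ : γ = fun s : ℝ => LinearMap.det
      ((LinearMap.id : EuclideanSpace ℝ (Fin 2) →ₗ[ℝ] EuclideanSpace ℝ (Fin 2))
        - s • (fderiv ℝ v x : EuclideanSpace ℝ (Fin 2) →ₗ[ℝ] EuclideanSpace ℝ (Fin 2))))
    (g' g'' : ℝ → ℝ) (M : ℝ)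
    (hg' : ∀ s ∈ Icc (0:ℝ) Δt,
      HasDerivWithinAt (fun s : ℝ => φ (x - s • v x, t - s) * γ s) (g' s) (Icc (0:ℝ) Δt) s)
    (hg'' : ∀ s ∈ Icc (0:ℝ) Δt, HasDerivWithinAt g' (g'' s) (Icc (0:ℝ) Δt) s)
    (hM : ∀ s ∈ Icc (0:ℝ) Δt, |g'' s| ≤ M) :
    |(φ (x, t) - φ (x - Δt • v x, t - Δt) * γ Δt) / Δt
        - (fderiv ℝ φ (x, t) (0, 1) + fderiv ℝ φ (x, t) (v x, 0)
          + φ (x, t) * LinearMap.trace ℝ (EuclideanSpace ℝ (Fin 2))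
              (fderiv ℝ v x : EuclideanSpace ℝ (Fin 2) →ₗ[ℝ] EuclideanSpace ℝ (Fin 2)))|
      ≤ M / 2 * Δt := by
  have hchar : HasDerivAt (fun s : ℝ => (x - s • v x, t - s)) (-v x, -1) 0 := by
    simpa using (((hasDerivAt_id (0 : ℝ)).smul_const (v x)).const_sub x).prodMk
      ((hasDerivAt_id (0 : ℝ)).const_sub t)
  have hφ_char : HasDerivAt (fun s : ℝ => φ (x - s • v x, t - s))
      (fderiv ℝ φ (x, t) (-v x, -1)) 0 :=
    HasFDerivAt.comp_hasDerivAt (0 : ℝ) (by simpa using hφ.hasFDerivAt) hchar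
  have hγ_deriv := LinearMap.hasDerivAt_det_id_sub_smul
    (fderiv ℝ v x : EuclideanSpace ℝ (Fin 2) →ₗ[ℝ] EuclideanSpace ℝ (Fin 2))
  rw [← hγ] at hγ_deriv
  have hγ_zero : γ 0 = 1 := by simp [hγ]
  have h0 : (0 : ℝ) ∈ Icc 0 Δt := left_mem_Icc.2 hΔt.le
  have hg'_zero := (uniqueDiffOn_Icc hΔt 0 h0).eq_deriv _ (hg' 0 h0)
    (hφ_char.mul hγ_deriv).hasDerivWithinAt
  have hsplit : fderiv ℝ φ (x, t) (-v x, -1) =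
      -(fderiv ℝ φ (x, t) (0, 1) + fderiv ℝ φ (x, t) (v x, 0)) := by
    rw [← map_add, ← map_neg]
    simp
  simp only [hsplit, hγ_zero, zero_smul, sub_zero, mul_one] at hg'_zero
  have taylor := norm_sub_sub_smul_le_of_hasDerivWithinAt hΔt.le hg' hg'' hM
  simp only [hg'_zero, hγ_zero, zero_smul, sub_zero, mul_one, smul_eq_mul,
    Real.norm_eq_abs] at taylor
  rw [← mul_le_mul_iff_left₀ hΔt]
  calc
    _ = _ := by
      rw [← abs_of_pos hΔt, ← abs_mul, abs_of_pos hΔt, ← abs_neg]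
      congr 1
      field_simp
      ring
    _ ≤ _ := taylor
    _ = _ := by ring
end

section
/- Fix x ∈ ℝ², t ∈ ℝ, Δt > 0, and a vector w ∈ ℝ². Let φ : ℝ² × ℝ → ℝ be differentiable at (x,t), and suppose the function g(s) := φ(x − s·w, t − s) is three times differentiable on [0, 2Δt] with |g'''(s)| ≤ M for all s ∈ [0, 2Δt]. Then the two-step (BDF2-type) backward characteristic quotient satisfies | (3φ(x,t) − 4φ(x − Δt·w, t − Δt) + φ(x − 2Δt·w, t − 2Δt))/(2Δt) − (∂φ/∂t(x,t) + w·∇φ(x,t)) | ≤ M·Δt²; i.e., the two-step Lagrange–Galerkin discretization of the non-conservative material derivative is second-order accurate in time. -/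
open Set

/-- A function vanishing at `0` whose derivative is bounded by `C * s ^ n` on `[0, b]` is bounded
by `C * s ^ (n + 1) / (n + 1)` there. -/
lemma abs_le_of_abs_deriv_le_pow {f f' : ℝ → ℝ} {b C : ℝ} (n : ℕ)
    (hf : ∀ s ∈ Icc (0:ℝ) b, HasDerivWithinAt f (f' s) (Icc 0 b) s) (h0 : f 0 = 0)
    (hC : ∀ s ∈ Icc (0:ℝ) b, |f' s| ≤ C * s ^ n) :
    ∀ s ∈ Icc (0:ℝ) b, |f s| ≤ C * s ^ (n + 1) / (n + 1) := by
  have hB : ∀ s : ℝ, HasDerivAt (fun s : ℝ => C * s ^ (n + 1) / (n + 1)) (C * s ^ n) s := by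
    intro s
    have hn : (n : ℝ) + 1 ≠ 0 := by positivity
    refine (((hasDerivAt_pow (n + 1) s).const_mul C).div_const ((n : ℝ) + 1)).congr_deriv ?_
    rw [div_eq_iff hn, Nat.add_sub_cancel]
    push_cast
    ring
  intro s hs
  refine image_norm_le_of_norm_deriv_right_le_deriv_boundary (f := f) (f' := f')
    (fun s hs => (hf s hs).continuousWithinAt) (fun s hs => ?_) ?_ hB
    (fun s hs => hC s (Ico_subset_Icc_self hs)) hs
  · exact (hf s (Ico_subset_Icc_self hs)).mono_of_mem_nhdsWithin
      (Filter.mem_of_superset (Icc_mem_nhdsGE hs.2) (Icc_subset_Icc_left hs.1))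
  · simp [h0]

/-- Second-order Taylor expansion at `0` with the Lagrange bound on the remainder. -/
lemma abs_taylor_two_remainder_le {g g' g'' g''' : ℝ → ℝ} {b M : ℝ}
    (hg' : ∀ s ∈ Icc (0:ℝ) b, HasDerivWithinAt g (g' s) (Icc 0 b) s)
    (hg'' : ∀ s ∈ Icc (0:ℝ) b, HasDerivWithinAt g' (g'' s) (Icc 0 b) s)
    (hg''' : ∀ s ∈ Icc (0:ℝ) b, HasDerivWithinAt g'' (g''' s) (Icc 0 b) s)
    (hM : ∀ s ∈ Icc (0:ℝ) b, |g''' s| ≤ M) :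
    ∀ s ∈ Icc (0:ℝ) b, |g s - g 0 - s * g' 0 - s ^ 2 / 2 * g'' 0| ≤ M * s ^ 3 / 6 := by
  have h₂ := abs_le_of_abs_deriv_le_pow (f := fun s => g'' s - g'' 0) (C := M) 0
    (fun s hs => (hg''' s hs).sub_const _) (by simp) (by simpa using hM)
  have h₁ := abs_le_of_abs_deriv_le_pow (f := fun s => g' s - g' 0 - s * g'' 0)
    (f' := fun s => g'' s - g'' 0) (C := M) 1
    (fun s hs => by
      simpa using ((hg'' s hs).sub_const (g' 0)).fun_sub
        ((hasDerivWithinAt_id s _).mul_const (g'' 0)))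
    (by simp) (fun s hs => by simpa using h₂ s hs)
  have h₀ := abs_le_of_abs_deriv_le_pow
    (f := fun s => g s - g 0 - s * g' 0 - s ^ 2 / 2 * g'' 0)
    (f' := fun s => g' s - g' 0 - s * g'' 0) (C := M / 2) 2
    (fun s hs => by
      simpa using (((hg' s hs).sub_const (g 0)).fun_sub
        ((hasDerivWithinAt_id s _).mul_const (g' 0))).fun_sub
        ((((hasDerivAt_pow 2 s).div_const 2).mul_const (g'' 0)).hasDerivWithinAt))
    (by simp) (fun s hs => (h₁ s hs).trans_eq (by norm_num; ring))
  exact fun s hs => (h₀ s hs).trans_eq (by norm_num; ring)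

/-- The two-step (BDF2-type) backward characteristic discretization of the
non-conservative material derivative `∂φ/∂t + w·∇φ` is second-order accurate in time. -/
theorem stmt_3
    (x : EuclideanSpace ℝ (Fin 2)) (t : ℝ) (Δt : ℝ) (hΔt : 0 < Δt)
    (w : EuclideanSpace ℝ (Fin 2))
    (φ : EuclideanSpace ℝ (Fin 2) × ℝ → ℝ)
    (hφ : DifferentiableAt ℝ φ (x, t))
    (g' g'' g''' : ℝ → ℝ) (M : ℝ)
    (hg' : ∀ s ∈ Icc (0:ℝ) (2 * Δt),
      HasDerivWithinAt (fun s : ℝ => φ (x - s • w, t - s)) (g' s) (Icc (0:ℝ) (2 * Δt)) s)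
    (hg'' : ∀ s ∈ Icc (0:ℝ) (2 * Δt), HasDerivWithinAt g' (g'' s) (Icc (0:ℝ) (2 * Δt)) s)
    (hg''' : ∀ s ∈ Icc (0:ℝ) (2 * Δt), HasDerivWithinAt g'' (g''' s) (Icc (0:ℝ) (2 * Δt)) s)
    (hM : ∀ s ∈ Icc (0:ℝ) (2 * Δt), |g''' s| ≤ M) :
    |(3 * φ (x, t) - 4 * φ (x - Δt • w, t - Δt) + φ (x - (2 * Δt) • w, t - 2 * Δt)) / (2 * Δt)
        - (fderiv ℝ φ (x, t) (0, 1) + fderiv ℝ φ (x, t) (w, 0))| ≤ M * Δt ^ 2 := by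
  have h0mem : (0:ℝ) ∈ Icc (0:ℝ) (2 * Δt) := ⟨le_rfl, by positivity⟩
  have hcurve : HasDerivAt (fun s : ℝ => (x - s • w, t - s)) (-w, (-1 : ℝ)) 0 := by
    have h₁ : HasDerivAt (fun s : ℝ => x - s • w) (-w) 0 := by
      simpa using ((hasDerivAt_id (0:ℝ)).smul_const w).const_sub x
    exact h₁.prodMk (by simpa using (hasDerivAt_id (0:ℝ)).const_sub t)
  have hchain : HasDerivAt (fun s : ℝ => φ (x - s • w, t - s))
      (fderiv ℝ φ (x, t) (-w, -1)) 0 :=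
    HasFDerivAt.comp_hasDerivAt (0:ℝ) (by simpa using hφ.hasFDerivAt) hcurve
  have hg0 : g' 0 = -(fderiv ℝ φ (x, t) (0, 1) + fderiv ℝ φ (x, t) (w, 0)) := by
    rw [(uniqueDiffOn_Icc (by positivity : (0:ℝ) < 2 * Δt) 0 h0mem).eq_deriv _ (hg' 0 h0mem)
      hchain.hasDerivWithinAt, ← map_add, ← map_neg]
    simp
  have hT := abs_taylor_two_remainder_le hg' hg'' hg''' hM
  have h₁ := abs_le.mp (hT Δt ⟨hΔt.le, by linarith⟩)
  have h₂ := abs_le.mp (hT (2 * Δt) ⟨by positivity, le_rfl⟩)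
  simp only [zero_smul, sub_zero] at h₁ h₂
  rw [← neg_eq_iff_eq_neg] at hg0
  rw [← hg0, div_sub' (by positivity), abs_div, abs_of_pos (by positivity : 0 < 2 * Δt),
    div_le_iff₀ (by positivity), abs_le]
  constructor <;> linarith [h₁.1, h₁.2, h₂.1, h₂.2]
end

section
/- Fix x ∈ ℝ², t ∈ ℝ, Δt > 0, and vectors w, w₀ ∈ ℝ² with ‖w − w₀‖ ≤ ε·Δt². Let φ : ℝ² × ℝ → ℝ be differentiable at (x,t) with ‖∇φ(x,t)‖ ≤ G, and suppose g(s) := φ(x − s·w, t − s) is three times differentiable on [0, 2Δt] with |g'''(s)| ≤ M. Then | (3φ(x,t) − 4φ(x − Δt·w, t − Δt) + φ(x − 2Δt·w, t − 2Δt))/(2Δt) − (∂φ/∂t(x,t) + w₀·∇φ(x,t)) | ≤ (M + εG)·Δt². In particular, using an extrapolated velocity w that approximates the exact velocity w₀ = u(x,t) to second order in Δt, the two-step characteristic discretization remains a second-order approximation of the material derivative ∂φ/∂t + u·∇φ at (x,t). -/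
open Set

theorem abs_le_pow_succ_of_abs_deriv_le_pow {f f' : ℝ → ℝ} {L C : ℝ} (n : ℕ)
    (hf : ∀ s ∈ Icc (0:ℝ) L, HasDerivWithinAt f (f' s) (Icc (0:ℝ) L) s)
    (h0 : f 0 = 0) (hb : ∀ s ∈ Icc (0:ℝ) L, |f' s| ≤ C * s ^ n) :
    ∀ s ∈ Icc (0:ℝ) L, |f s| ≤ C / (n + 1) * s ^ (n + 1) := by
  have hB : ∀ s : ℝ, HasDerivAt (fun s => C / (n + 1) * s ^ (n + 1)) (C * s ^ n) s := by
    intro s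
    have h := (hasDerivAt_pow (n + 1) s).const_mul (C / ((n : ℝ) + 1))
    refine h.congr_deriv ?_
    push_cast
    field_simp
  intro s hs
  refine image_norm_le_of_norm_deriv_right_le_deriv_boundary (f := f) (f' := f')
    (fun s hs => (hf s hs).continuousWithinAt)
    (fun s hs => (hf s (Ico_subset_Icc_self hs)).mono_of_mem_nhdsWithin
      (Icc_mem_nhdsGE_of_mem hs)) ?_ hB
    (fun s hs => hb s (Ico_subset_Icc_self hs)) hs
  simp [h0]

theorem abs_sub_taylor_two_le {g g' g'' g''' : ℝ → ℝ} {L M : ℝ}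
    (hg' : ∀ s ∈ Icc (0:ℝ) L, HasDerivWithinAt g (g' s) (Icc (0:ℝ) L) s)
    (hg'' : ∀ s ∈ Icc (0:ℝ) L, HasDerivWithinAt g' (g'' s) (Icc (0:ℝ) L) s)
    (hg''' : ∀ s ∈ Icc (0:ℝ) L, HasDerivWithinAt g'' (g''' s) (Icc (0:ℝ) L) s)
    (hM : ∀ s ∈ Icc (0:ℝ) L, |g''' s| ≤ M) :
    ∀ s ∈ Icc (0:ℝ) L, |g s - (g 0 + g' 0 * s + g'' 0 / 2 * s ^ 2)| ≤ M / 6 * s ^ 3 := by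
  have second := abs_le_pow_succ_of_abs_deriv_le_pow (f := fun s => g'' s - g'' 0) (C := M) 0
    (fun s hs => (hg''' s hs).sub_const _) (by simp) (by simpa using hM)
  have first := abs_le_pow_succ_of_abs_deriv_le_pow
    (f := fun s => g' s - (g' 0 + g'' 0 * s)) 1
    (fun s hs => (hg'' s hs).sub
      (by simpa using (((hasDerivAt_id s).const_mul (g'' 0)).const_add (g' 0)).hasDerivWithinAt))
    (by simp) second
  have zeroth := abs_le_pow_succ_of_abs_deriv_le_pow
    (f := fun s => g s - (g 0 + g' 0 * s + g'' 0 / 2 * s ^ 2)) 2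
    (fun s hs => (hg' s hs).sub (by
      have h := (((hasDerivAt_id s).const_mul (g' 0)).const_add (g 0)).add
        ((hasDerivAt_pow 2 s).const_mul (g'' 0 / 2))
      refine (h.congr_deriv ?_).hasDerivWithinAt
      push_cast
      ring))
    (by simp) first
  intro s hs
  refine (zeroth s hs).trans_eq ?_
  push_cast
  ring

/-- Using an extrapolated velocity `w` that approximates the exact velocity `w₀` to
second order in `Δt` (`‖w − w₀‖ ≤ ε·Δt²`), the two-step characteristic discretization
remains a second-order approximation of the material derivative `∂φ/∂t + w₀·∇φ` at
`(x,t)`, with constant `M + εG` where `G` bounds `‖∇φ(x,t)‖`. -/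
theorem stmt_5
    (x : EuclideanSpace ℝ (Fin 2)) (t : ℝ) (Δt : ℝ) (hΔt : 0 < Δt)
    (w w₀ : EuclideanSpace ℝ (Fin 2)) (ε : ℝ)
    (hw : ‖w - w₀‖ ≤ ε * Δt ^ 2)
    (φ : EuclideanSpace ℝ (Fin 2) × ℝ → ℝ)
    (hφ : DifferentiableAt ℝ φ (x, t))
    (G : ℝ) (hG : ∀ y : EuclideanSpace ℝ (Fin 2), |fderiv ℝ φ (x, t) (y, 0)| ≤ G * ‖y‖)
    (g' g'' g''' : ℝ → ℝ) (M : ℝ)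
    (hg' : ∀ s ∈ Icc (0:ℝ) (2 * Δt),
      HasDerivWithinAt (fun s : ℝ => φ (x - s • w, t - s)) (g' s) (Icc (0:ℝ) (2 * Δt)) s)
    (hg'' : ∀ s ∈ Icc (0:ℝ) (2 * Δt), HasDerivWithinAt g' (g'' s) (Icc (0:ℝ) (2 * Δt)) s)
    (hg''' : ∀ s ∈ Icc (0:ℝ) (2 * Δt), HasDerivWithinAt g'' (g''' s) (Icc (0:ℝ) (2 * Δt)) s)
    (hM : ∀ s ∈ Icc (0:ℝ) (2 * Δt), |g''' s| ≤ M) :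
    |(3 * φ (x, t) - 4 * φ (x - Δt • w, t - Δt) + φ (x - (2 * Δt) • w, t - 2 * Δt)) / (2 * Δt)
        - (fderiv ℝ φ (x, t) (0, 1) + fderiv ℝ φ (x, t) (w₀, 0))|
      ≤ (M + ε * G) * Δt ^ 2 := by
  have taylor := abs_sub_taylor_two_le hg' hg'' hg''' hM
  have h₁ := taylor Δt ⟨hΔt.le, by linarith⟩
  have h₂ := taylor (2 * Δt) ⟨by linarith, le_rfl⟩
  have hzero : (0:ℝ) ∈ Icc (0:ℝ) (2 * Δt) := ⟨le_rfl, by linarith⟩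
  have hg0 : g' 0 = -(fderiv ℝ φ (x, t) (0, 1) + fderiv ℝ φ (x, t) (w, 0)) := by
    have hline : HasDerivAt (fun s : ℝ => (x - s • w, t - s)) (-w, (-1 : ℝ)) 0 := by
      have hx := ((hasDerivAt_id (0:ℝ)).smul_const w).const_sub x
      have ht := (hasDerivAt_id (0:ℝ)).const_sub t
      simpa using hx.prodMk ht
    have hφ' : HasFDerivAt φ (fderiv ℝ φ (x, t)) (x - (0:ℝ) • w, t - 0) := by
      simpa using hφ.hasFDerivAt
    have hcomp := (hφ'.comp_hasDerivAt (0:ℝ) hline).hasDerivWithinAt (s := Icc 0 (2 * Δt))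
    have huniq := (uniqueDiffOn_Icc (by linarith : (0:ℝ) < 2 * Δt)) 0 hzero
    rw [huniq.eq_deriv _ (hg' 0 hzero) hcomp, ← map_add, ← map_neg]
    simp
  have hGnonneg : 0 ≤ G := by
    simpa using (abs_nonneg _).trans (hG (EuclideanSpace.single 0 1))
  have hvel : |fderiv ℝ φ (x, t) (w, 0) - fderiv ℝ φ (x, t) (w₀, 0)| ≤ ε * G * Δt ^ 2 := by
    have hy := hG (w - w₀)
    rw [show ((w - w₀, 0) : EuclideanSpace ℝ (Fin 2) × ℝ) = (w, 0) - (w₀, 0) by simp,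
      map_sub] at hy
    nlinarith [mul_le_mul_of_nonneg_left hw hGnonneg]
  have hdisc : |(3 * φ (x, t) - 4 * φ (x - Δt • w, t - Δt)
      + φ (x - (2 * Δt) • w, t - 2 * Δt)) / (2 * Δt) + g' 0| ≤ M * Δt ^ 2 := by
    simp only [zero_smul, sub_zero] at h₁ h₂
    rw [abs_le] at h₁ h₂
    rw [div_add' _ _ _ (by positivity), abs_div, abs_of_pos (by positivity : 0 < 2 * Δt),
      div_le_iff₀ (by positivity), abs_le]
    constructor <;> linarith [h₁.1, h₁.2, h₂.1, h₂.2]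
  rw [hg0] at hdisc
  rw [abs_le] at hdisc hvel ⊢
  constructor <;> linarith [hdisc.1, hdisc.2, hvel.1, hvel.2]
end

section
/- Let a, b, T > 0, Ω = (0,a)×(0,b) ⊂ ℝ², and let ρ, μ, g, ζ > 0 be constants. Let η : [0,a]×[0,b]×[0,T] → ℝ be continuously differentiable, φ := η + ζ, and u : [0,a]×[0,b]×[0,T] → ℝ² be twice continuously differentiable, and suppose they satisfy the shallow water equations ∂φ/∂t + ∇·(uφ) = 0 and ρφ[∂u/∂t + (u·∇)u] − 2μ∇·(φD(u)) + ρgφ∇η = 0 on Ω × (0,T), together with the homogeneous Dirichlet condition u = 0 on ∂Ω × [0,T]. Then the total energy E(t) := ∫_Ω (ρ/2)φ|u|² dx + ∫_Ω (ρg/2)|η|² dx is differentiable on (0,T) with E'(t) = −2μ ∫_Ω φ(x,t) D(u)(x,t) : D(u)(x,t) dx; i.e., with pure Dirichlet boundary conditions the only change of total energy is viscous dissipation. -/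
open Set MeasureTheory

/-- Partial derivative in the `x₁` direction of a function of `(x₁, x₂, t)`. -/
noncomputable def pd1 (f : ℝ × ℝ × ℝ → ℝ) (p : ℝ × ℝ × ℝ) : ℝ := fderiv ℝ f p (1, 0, 0)

/-- Partial derivative in the `x₂` direction of a function of `(x₁, x₂, t)`. -/
noncomputable def pd2 (f : ℝ × ℝ × ℝ → ℝ) (p : ℝ × ℝ × ℝ) : ℝ := fderiv ℝ f p (0, 1, 0)

/-- Partial derivative in the time direction of a function of `(x₁, x₂, t)`. -/
noncomputable def pdt (f : ℝ × ℝ × ℝ → ℝ) (p : ℝ × ℝ × ℝ) : ℝ := fderiv ℝ f p (0, 0, 1)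

/-- Entry `(1,1)` of the strain-rate tensor `D(u) = (∇u + (∇u)ᵀ)/2`. -/
noncomputable def D11 (u₁ u₂ : ℝ × ℝ × ℝ → ℝ) (p : ℝ × ℝ × ℝ) : ℝ := pd1 u₁ p

/-- Entry `(1,2) = (2,1)` of the strain-rate tensor `D(u) = (∇u + (∇u)ᵀ)/2`. -/
noncomputable def D12 (u₁ u₂ : ℝ × ℝ × ℝ → ℝ) (p : ℝ × ℝ × ℝ) : ℝ :=
  (pd2 u₁ p + pd1 u₂ p) / 2

/-- Entry `(2,2)` of the strain-rate tensor `D(u) = (∇u + (∇u)ᵀ)/2`. -/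
noncomputable def D22 (u₁ u₂ : ℝ × ℝ × ℝ → ℝ) (p : ℝ × ℝ × ℝ) : ℝ := pd2 u₂ p

open Filter Topology

section SpaceTimeBox

variable {a b T t : ℝ} {F G : ℝ × ℝ × ℝ → ℝ}

lemma uniqueDiffOn_box (ha : 0 < a) (hb : 0 < b) (hT : 0 < T) :
    UniqueDiffOn ℝ (Icc 0 a ×ˢ Icc 0 b ×ˢ Icc 0 T) :=
  (uniqueDiffOn_Icc ha).prod ((uniqueDiffOn_Icc hb).prod (uniqueDiffOn_Icc hT))

lemma box_mem_nhds {p : ℝ × ℝ × ℝ} (hp : p ∈ Ioo 0 a ×ˢ Ioo 0 b ×ˢ Ioo 0 T) :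
    Icc 0 a ×ˢ Icc 0 b ×ˢ Icc 0 T ∈ 𝓝 p :=
  prod_mem_nhds (Icc_mem_nhds hp.1.1 hp.1.2)
    (prod_mem_nhds (Icc_mem_nhds hp.2.1.1 hp.2.1.2) (Icc_mem_nhds hp.2.2.1 hp.2.2.2))

lemma ContDiffOn.differentiableAt_box (hF : ContDiffOn ℝ 1 F (Icc 0 a ×ˢ Icc 0 b ×ˢ Icc 0 T))
    {p : ℝ × ℝ × ℝ} (hp : p ∈ Ioo 0 a ×ˢ Ioo 0 b ×ˢ Ioo 0 T) : DifferentiableAt ℝ F p :=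
  (hF.contDiffAt (box_mem_nhds hp)).differentiableAt one_ne_zero

/-- A function continuous on the closed box is integrable on each open time slice. -/
lemma ContinuousOn.integrableOn_slice
    (hF : ContinuousOn F (Icc 0 a ×ˢ Icc 0 b ×ˢ Icc 0 T)) (ht : t ∈ Icc 0 T) :
    IntegrableOn (fun x : ℝ × ℝ => F (x.1, x.2, t)) (Ioo 0 a ×ˢ Ioo 0 b) := by
  have hc : ContinuousOn (fun x : ℝ × ℝ => F (x.1, x.2, t)) (Icc 0 a ×ˢ Icc 0 b) :=
    hF.comp (by fun_prop) fun x hx => ⟨hx.1, hx.2, ht⟩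
  exact (hc.integrableOn_compact (isCompact_Icc.prod isCompact_Icc)).mono_set
    (prod_mono Ioo_subset_Icc_self Ioo_subset_Icc_self)

lemma ContDiffOn.integrableOn_fderiv_slice (ha : 0 < a) (hb : 0 < b)
    (hF : ContDiffOn ℝ 1 F (Icc 0 a ×ˢ Icc 0 b ×ˢ Icc 0 T)) (ht : t ∈ Ioo 0 T)
    (v : ℝ × ℝ × ℝ) :
    IntegrableOn (fun x : ℝ × ℝ => fderiv ℝ F (x.1, x.2, t) v) (Ioo 0 a ×ˢ Ioo 0 b) := by
  have hc := (hF.continuousOn_fderivWithin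
    (uniqueDiffOn_box ha hb (ht.1.trans ht.2)) le_rfl).clm_apply
      (continuousOn_const (c := v))
  refine (hc.integrableOn_slice (Ioo_subset_Icc_self ht)).congr_fun (fun x hx => ?_)
    (measurableSet_Ioo.prod measurableSet_Ioo)
  simp only [fderivWithin_of_mem_nhds (box_mem_nhds (p := (x.1, x.2, t)) ⟨hx.1, hx.2, ht⟩)]

/-- Differentiation under the integral sign over a rectangle. -/
lemma ContDiffOn.hasDerivAt_integral_slice (ha : 0 < a) (hb : 0 < b)
    (hF : ContDiffOn ℝ 1 F (Icc 0 a ×ˢ Icc 0 b ×ˢ Icc 0 T)) (ht : t ∈ Ioo 0 T) :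
    HasDerivAt (fun τ : ℝ => ∫ x in Ioo 0 a ×ˢ Ioo 0 b, F (x.1, x.2, τ))
      (∫ x in Ioo 0 a ×ˢ Ioo 0 b, pdt F (x.1, x.2, t)) t := by
  have hT := ht.1.trans ht.2
  have hcompact : IsCompact (Icc 0 a ×ˢ Icc 0 b ×ˢ Icc 0 T) :=
    isCompact_Icc.prod (isCompact_Icc.prod isCompact_Icc)
  obtain ⟨C, hC⟩ := hcompact.exists_bound_of_continuousOn
    ((hF.continuousOn_fderivWithin (uniqueDiffOn_box ha hb hT) le_rfl).clm_apply
      (continuousOn_const (c := ((0, 0, 1) : ℝ × ℝ × ℝ))))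
  have hs : MeasurableSet (Ioo 0 a ×ˢ Ioo 0 b) := measurableSet_Ioo.prod measurableSet_Ioo
  refine (hasDerivAt_integral_of_dominated_loc_of_deriv_le (bound := fun _ => C)
    (F := fun τ (x : ℝ × ℝ) => F (x.1, x.2, τ)) (F' := fun τ x => pdt F (x.1, x.2, τ))
    (Ioo_mem_nhds ht.1 ht.2) ?_ ?_ ?_ ?_ ?_ ?_).2
  · filter_upwards [Ioo_mem_nhds ht.1 ht.2] with τ hτ
    exact (hF.continuousOn.integrableOn_slice (Ioo_subset_Icc_self hτ)).aestronglyMeasurable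
  · exact hF.continuousOn.integrableOn_slice (Ioo_subset_Icc_self ht)
  · exact (hF.integrableOn_fderiv_slice ha hb ht _).aestronglyMeasurable
  · refine (ae_restrict_iff' hs).2 (ae_of_all _ fun x hx τ hτ => ?_)
    have hp : (x.1, x.2, τ) ∈ Ioo 0 a ×ˢ Ioo 0 b ×ˢ Ioo 0 T := ⟨hx.1, hx.2, hτ⟩
    rw [pdt, ← fderivWithin_of_mem_nhds (box_mem_nhds hp)]
    exact hC _ (mem_of_mem_nhds (box_mem_nhds hp))
  · exact (ContinuousOn.integrableOn_slice (F := fun _ => C) (T := T) continuousOn_const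
      (Ioo_subset_Icc_self ht))
  · refine (ae_restrict_iff' hs).2 (ae_of_all _ fun x hx τ hτ => ?_)
    have hp : (x.1, x.2, τ) ∈ Ioo 0 a ×ˢ Ioo 0 b ×ˢ Ioo 0 T := ⟨hx.1, hx.2, hτ⟩
    exact (hF.differentiableAt_box hp).hasFDerivAt.comp_hasDerivAt τ
      ((hasDerivAt_const τ x.1).prodMk ((hasDerivAt_const τ x.2).prodMk (hasDerivAt_id τ)))

/-- The spatial divergence of a flux vanishing on the lateral boundary has zero integral. -/
lemma ContDiffOn.integral_divergence_slice_eq_zero (ha : 0 < a) (hb : 0 < b)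
    (hF : ContDiffOn ℝ 1 F (Icc 0 a ×ˢ Icc 0 b ×ˢ Icc 0 T))
    (hG : ContDiffOn ℝ 1 G (Icc 0 a ×ˢ Icc 0 b ×ˢ Icc 0 T)) (ht : t ∈ Ioo 0 T)
    (hF0 : ∀ y ∈ Icc 0 b, F (0, y, t) = 0 ∧ F (a, y, t) = 0)
    (hG0 : ∀ x ∈ Icc 0 a, G (x, 0, t) = 0 ∧ G (x, b, t) = 0) :
    ∫ x in Ioo 0 a ×ˢ Ioo 0 b, (pd1 F (x.1, x.2, t) + pd2 G (x.1, x.2, t)) = 0 := by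
  let ι : ℝ × ℝ →L[ℝ] ℝ × ℝ × ℝ :=
    (ContinuousLinearMap.fst ℝ ℝ ℝ).prod ((ContinuousLinearMap.snd ℝ ℝ ℝ).prod 0)
  have hι (x : ℝ × ℝ) : HasFDerivAt (fun y : ℝ × ℝ => (y.1, y.2, t)) ι x :=
    hasFDerivAt_fst.prodMk (hasFDerivAt_snd.prodMk (hasFDerivAt_const t x))
  have hcont {H : ℝ × ℝ × ℝ → ℝ} (hH : ContDiffOn ℝ 1 H (Icc 0 a ×ˢ Icc 0 b ×ˢ Icc 0 T)) :
      ContinuousOn (fun x : ℝ × ℝ => H (x.1, x.2, t)) (Icc ((0, 0) : ℝ × ℝ) (a, b)) := by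
    rw [← Icc_prod_Icc]
    exact hH.continuousOn.comp (by fun_prop) fun x hx => ⟨hx.1, hx.2, Ioo_subset_Icc_self ht⟩
  have hderiv {H : ℝ × ℝ × ℝ → ℝ} (hH : ContDiffOn ℝ 1 H (Icc 0 a ×ˢ Icc 0 b ×ˢ Icc 0 T))
      (x : ℝ × ℝ) (hx : x ∈ Ioo 0 a ×ˢ Ioo 0 b) :
      HasFDerivAt (fun x : ℝ × ℝ => H (x.1, x.2, t)) ((fderiv ℝ H (x.1, x.2, t)).comp ι) x :=
    (hH.differentiableAt_box (p := (x.1, x.2, t)) ⟨hx.1, hx.2, ht⟩).hasFDerivAt.comp x (hι x)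
  have hae : (Ioo 0 a ×ˢ Ioo 0 b : Set (ℝ × ℝ)) =ᵐ[volume] Icc ((0, 0) : ℝ × ℝ) (a, b) := by
    rw [← Icc_prod_Icc]
    exact Measure.set_prod_ae_eq Ioo_ae_eq_Icc Ioo_ae_eq_Icc
  have hdiv := integral_divergence_prod_Icc_of_hasFDerivAt_of_le _ _ _ _
    ((0, 0) : ℝ × ℝ) (a, b) ⟨ha.le, hb.le⟩ (hcont hF) (hcont hG) (hderiv hF) (hderiv hG)
    ((integrableOn_congr_set_ae hae).1 <|
      ((hF.integrableOn_fderiv_slice ha hb ht (1, 0, 0)).add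
        (hG.integrableOn_fderiv_slice ha hb ht (0, 1, 0))))
  have hGz {y : ℝ} (hy : ∀ x ∈ Icc 0 a, G (x, y, t) = 0) : ∫ x in (0 : ℝ)..a, G (x, y, t) = 0 :=
    intervalIntegral.integral_zero_ae (ae_of_all _ fun x hx => hy x (by
      rw [uIoc_of_le ha.le] at hx; exact Ioc_subset_Icc_self hx))
  have hFz {x : ℝ} (hx : ∀ y ∈ Icc 0 b, F (x, y, t) = 0) : ∫ y in (0 : ℝ)..b, F (x, y, t) = 0 :=
    intervalIntegral.integral_zero_ae (ae_of_all _ fun y hy => hx y (by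
      rw [uIoc_of_le hb.le] at hy; exact Ioc_subset_Icc_self hy))
  rw [hGz fun x hx => (hG0 x hx).1, hGz fun x hx => (hG0 x hx).2,
    hFz fun y hy => (hF0 y hy).1, hFz fun y hy => (hF0 y hy).2] at hdiv
  rw [setIntegral_congr_set hae]
  simpa [ι, pd1, pd2] using hdiv

end SpaceTimeBox

/-- Energy identity for the shallow water equations with flat bottom `ζ` and pure
homogeneous Dirichlet boundary conditions on the rectangle `Ω = (0,a) × (0,b)`:
the total energy `E(t) = ∫_Ω (ρ/2)φ|u|² dx + ∫_Ω (ρg/2)|η|² dx` (with `φ = η + ζ`)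
is differentiable on `(0,T)` and `E'(t) = −2μ ∫_Ω φ D(u) : D(u) dx`, where
`D(u) : D(u) = D₁₁² + 2D₁₂² + D₂₂²`. -/
theorem stmt_10
    (a b T ρ μ g ζ : ℝ) (ha : 0 < a) (hb : 0 < b) (hT : 0 < T)
    (hρ : 0 < ρ) (hμ : 0 < μ) (hg : 0 < g) (hζ : 0 < ζ)
    (η u₁ u₂ : ℝ × ℝ × ℝ → ℝ)
    (hη : ContDiffOn ℝ 1 η (Icc 0 a ×ˢ Icc 0 b ×ˢ Icc 0 T))
    (hu₁ : ContDiffOn ℝ 2 u₁ (Icc 0 a ×ˢ Icc 0 b ×ˢ Icc 0 T))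
    (hu₂ : ContDiffOn ℝ 2 u₂ (Icc 0 a ×ˢ Icc 0 b ×ˢ Icc 0 T))
    (hmass : ∀ p ∈ Ioo 0 a ×ˢ Ioo 0 b ×ˢ Ioo 0 T,
      pdt (fun q => η q + ζ) p + pd1 (fun q => u₁ q * (η q + ζ)) p
        + pd2 (fun q => u₂ q * (η q + ζ)) p = 0)
    (hmom₁ : ∀ p ∈ Ioo 0 a ×ˢ Ioo 0 b ×ˢ Ioo 0 T,
      ρ * (η p + ζ) * (pdt u₁ p + u₁ p * pd1 u₁ p + u₂ p * pd2 u₁ p)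
        - 2 * μ * (pd1 (fun q => (η q + ζ) * D11 u₁ u₂ q) p
            + pd2 (fun q => (η q + ζ) * D12 u₁ u₂ q) p)
        + ρ * g * (η p + ζ) * pd1 η p = 0)
    (hmom₂ : ∀ p ∈ Ioo 0 a ×ˢ Ioo 0 b ×ˢ Ioo 0 T,
      ρ * (η p + ζ) * (pdt u₂ p + u₁ p * pd1 u₂ p + u₂ p * pd2 u₂ p)
        - 2 * μ * (pd1 (fun q => (η q + ζ) * D12 u₁ u₂ q) p
            + pd2 (fun q => (η q + ζ) * D22 u₁ u₂ q) p)
        + ρ * g * (η p + ζ) * pd2 η p = 0)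
    (hbc : ∀ x₁ ∈ Icc 0 a, ∀ x₂ ∈ Icc 0 b, ∀ t ∈ Icc 0 T,
      (x₁ = 0 ∨ x₁ = a ∨ x₂ = 0 ∨ x₂ = b) →
        u₁ (x₁, x₂, t) = 0 ∧ u₂ (x₁, x₂, t) = 0) :
    ∀ t ∈ Ioo 0 T,
      HasDerivAt (fun τ : ℝ =>
          (∫ x in Ioo 0 a ×ˢ Ioo 0 b,
            ρ / 2 * (η (x.1, x.2, τ) + ζ) * (u₁ (x.1, x.2, τ) ^ 2 + u₂ (x.1, x.2, τ) ^ 2))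
          + ∫ x in Ioo 0 a ×ˢ Ioo 0 b, ρ * g / 2 * η (x.1, x.2, τ) ^ 2)
        (-(2 * μ) * ∫ x in Ioo 0 a ×ˢ Ioo 0 b,
          (η (x.1, x.2, t) + ζ) * (D11 u₁ u₂ (x.1, x.2, t) ^ 2
            + 2 * D12 u₁ u₂ (x.1, x.2, t) ^ 2 + D22 u₁ u₂ (x.1, x.2, t) ^ 2)) t := by
  intro t ht
  set K : Set (ℝ × ℝ × ℝ) := Icc 0 a ×ˢ Icc 0 b ×ˢ Icc 0 T with hK
  have hKu : UniqueDiffOn ℝ K := uniqueDiffOn_box ha hb hT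
  have hv₁ : ContDiffOn ℝ 1 u₁ K := hu₁.of_le one_le_two
  have hv₂ : ContDiffOn ℝ 1 u₂ K := hu₂.of_le one_le_two
  -- `C¹` extensions of the strain rates up to the boundary
  have hpart {w : ℝ × ℝ × ℝ → ℝ} (hw : ContDiffOn ℝ 2 w K) (v : ℝ × ℝ × ℝ) :
      ContDiffOn ℝ 1 (fun q => fderivWithin ℝ w K q v) K :=
    (hw.fderivWithin hKu (by norm_num [one_add_one_eq_two])).clm_apply contDiffOn_const
  obtain ⟨d11, hd11, hD11⟩ : ∃ d, ContDiffOn ℝ 1 d K ∧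
      ∀ p ∈ Ioo 0 a ×ˢ Ioo 0 b ×ˢ Ioo 0 T, D11 u₁ u₂ p = d p :=
    ⟨_, hpart hu₁ (1, 0, 0), fun p hp => by
      simp only [D11, pd1, hK, fderivWithin_of_mem_nhds (box_mem_nhds hp)]⟩
  obtain ⟨d12, hd12, hD12⟩ : ∃ d, ContDiffOn ℝ 1 d K ∧
      ∀ p ∈ Ioo 0 a ×ˢ Ioo 0 b ×ˢ Ioo 0 T, D12 u₁ u₂ p = d p :=
    ⟨_, ((hpart hu₁ (0, 1, 0)).add (hpart hu₂ (1, 0, 0))).div_const 2, fun p hp => by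
      simp only [D12, pd1, pd2, hK, fderivWithin_of_mem_nhds (box_mem_nhds hp)]⟩
  obtain ⟨d22, hd22, hD22⟩ : ∃ d, ContDiffOn ℝ 1 d K ∧
      ∀ p ∈ Ioo 0 a ×ˢ Ioo 0 b ×ˢ Ioo 0 T, D22 u₁ u₂ p = d p :=
    ⟨_, hpart hu₂ (0, 1, 0), fun p hp => by
      simp only [D22, pd2, hK, fderivWithin_of_mem_nhds (box_mem_nhds hp)]⟩
  have hopen : IsOpen (Ioo 0 a ×ˢ Ioo 0 b ×ˢ Ioo 0 T) :=
    isOpen_Ioo.prod (isOpen_Ioo.prod isOpen_Ioo)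
  have hstress {D d : ℝ × ℝ × ℝ → ℝ} (h : ∀ p ∈ Ioo 0 a ×ˢ Ioo 0 b ×ˢ Ioo 0 T, D p = d p)
      (p : ℝ × ℝ × ℝ) (hp : p ∈ Ioo 0 a ×ˢ Ioo 0 b ×ˢ Ioo 0 T) :
      fderiv ℝ (fun q => (η q + ζ) * D q) p = fderiv ℝ (fun q => (η q + ζ) * d q) p := by
    refine EventuallyEq.fderiv_eq ?_
    filter_upwards [hopen.mem_nhds hp] with q hq
    rw [h q hq]
  -- kinetic and potential energy densities, and the energy flux
  let e₁ : ℝ × ℝ × ℝ → ℝ := fun q => ρ / 2 * (η q + ζ) * (u₁ q ^ 2 + u₂ q ^ 2)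
  let e₂ : ℝ × ℝ × ℝ → ℝ := fun q => ρ * g / 2 * η q ^ 2
  let F : ℝ × ℝ × ℝ → ℝ := fun q =>
    (2 * μ) * (u₁ q * ((η q + ζ) * d11 q) + u₂ q * ((η q + ζ) * d12 q))
      - (ρ / 2 * (u₁ q ^ 2 + u₂ q ^ 2) + ρ * g * η q) * (u₁ q * (η q + ζ))
  let G : ℝ × ℝ × ℝ → ℝ := fun q =>
    (2 * μ) * (u₁ q * ((η q + ζ) * d12 q) + u₂ q * ((η q + ζ) * d22 q))
      - (ρ / 2 * (u₁ q ^ 2 + u₂ q ^ 2) + ρ * g * η q) * (u₂ q * (η q + ζ))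
  have he₁ : ContDiffOn ℝ 1 e₁ K := by fun_prop
  have he₂ : ContDiffOn ℝ 1 e₂ K := by fun_prop
  have hF : ContDiffOn ℝ 1 F K := by fun_prop
  have hG : ContDiffOn ℝ 1 G K := by fun_prop
  have hdiv : ∫ x in Ioo 0 a ×ˢ Ioo 0 b, (pd1 F (x.1, x.2, t) + pd2 G (x.1, x.2, t)) = 0 := by
    have ht' := Ioo_subset_Icc_self ht
    refine hF.integral_divergence_slice_eq_zero ha hb hG ht (fun y hy => ?_) fun x hx => ?_
    · obtain ⟨h₁, h₂⟩ := hbc 0 (left_mem_Icc.2 ha.le) y hy t ht' (by simp)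
      obtain ⟨h₃, h₄⟩ := hbc a (right_mem_Icc.2 ha.le) y hy t ht' (by simp)
      simp [F, h₁, h₂, h₃, h₄]
    · obtain ⟨h₁, h₂⟩ := hbc x hx 0 (left_mem_Icc.2 hb.le) t ht' (by simp)
      obtain ⟨h₃, h₄⟩ := hbc x hx b (right_mem_Icc.2 hb.le) t ht' (by simp)
      simp [G, h₁, h₂, h₃, h₄]
  have hbalance : ∀ p ∈ Ioo 0 a ×ˢ Ioo 0 b ×ˢ Ioo 0 T,
      -(2 * μ) * ((η p + ζ) * (D11 u₁ u₂ p ^ 2 + 2 * D12 u₁ u₂ p ^ 2 + D22 u₁ u₂ p ^ 2))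
        = (pdt e₁ p + pdt e₂ p) - (pd1 F p + pd2 G p) := by
    intro p hp
    have h0 := hη.differentiableAt_box hp
    have h1 := hv₁.differentiableAt_box hp
    have h2 := hv₂.differentiableAt_box hp
    have h11 := hd11.differentiableAt_box hp
    have h12 := hd12.differentiableAt_box hp
    have h22 := hd22.differentiableAt_box hp
    have m0 := hmass p hp
    have m1 := hmom₁ p hp
    have m2 := hmom₂ p hp
    have e11 := hD11 p hp
    have e12 := hD12 p hp
    have e22 := hD22 p hp
    simp only [pd1, pd2, pdt, hstress hD11 p hp, hstress hD12 p hp, hstress hD22 p hp] at m1 m2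
    rw [e11, e12, e22]
    simp only [D11, D12, D22, pd1, pd2] at e11 e12 e22
    simp only [pd1, pd2, pdt] at m0
    simp only [pd1, pd2, pdt, e₁, e₂, F, G]
    simp (disch := fun_prop) only [fderiv_fun_add, fderiv_fun_sub, fderiv_fun_mul, fderiv_fun_pow,
      fderiv_fun_const, Pi.zero_apply, add_apply, sub_apply, smul_apply, zero_apply,
      smul_eq_mul, nsmul_eq_mul] at m0 m1 m2 ⊢
    linear_combination -(ρ / 2 * (u₁ p ^ 2 + u₂ p ^ 2) + ρ * g * η p) * m0 - u₁ p * m1 - u₂ p * m2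
      + 2 * μ * (η p + ζ) * (d11 p * e11 + 2 * d12 p * e12 + d22 p * e22)
  have hderiv := (he₁.hasDerivAt_integral_slice ha hb ht).add
    (he₂.hasDerivAt_integral_slice ha hb ht)
  refine hderiv.congr_deriv ?_
  have hi {H : ℝ × ℝ × ℝ → ℝ} (hH : ContDiffOn ℝ 1 H K) (v : ℝ × ℝ × ℝ) :=
    hH.integrableOn_fderiv_slice ha hb ht v
  have hie : IntegrableOn (fun x : ℝ × ℝ => pdt e₁ (x.1, x.2, t) + pdt e₂ (x.1, x.2, t))
      (Ioo 0 a ×ˢ Ioo 0 b) := (hi he₁ _).add (hi he₂ _)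
  have hidiv : IntegrableOn (fun x : ℝ × ℝ => pd1 F (x.1, x.2, t) + pd2 G (x.1, x.2, t))
      (Ioo 0 a ×ˢ Ioo 0 b) := (hi hF _).add (hi hG _)
  rw [← integral_const_mul, setIntegral_congr_fun (measurableSet_Ioo.prod measurableSet_Ioo)
      fun x hx => hbalance (x.1, x.2, t) ⟨hx.1, hx.2, ht⟩,
    integral_sub hie hidiv, hdiv, sub_zero]
  exact (integral_add (hi he₁ _) (hi he₂ _)).symm
end

section
/- Under the hypotheses of the Dirichlet energy identity — Ω = (0,a)×(0,b), constants ρ, μ, g, ζ > 0, smooth (φ = η + ζ, u) solving ∂φ/∂t + ∇·(uφ) = 0 and ρφ[∂u/∂t + (u·∇)u] − 2μ∇·(φD(u)) + ρgφ∇η = 0 on Ω × (0,T) with u = 0 on ∂Ω × [0,T] — assume additionally that φ(x,t) ≥ 0 for all (x,t). Then the total energy E(t) := ∫_Ω (ρ/2)φ|u|² dx + ∫_Ω (ρg/2)|η|² dx is nonincreasing on [0,T]. -/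
open Set MeasureTheory

/-- The continuous linear map `x ↦ (x 0, x 1, x 2)`. -/
noncomputable def finThreeToProd : (Fin 3 → ℝ) →L[ℝ] ℝ × ℝ × ℝ :=
  (ContinuousLinearMap.proj 0).prod
    ((ContinuousLinearMap.proj 1).prod (ContinuousLinearMap.proj 2))

theorem finThreeToProd_apply (x : Fin 3 → ℝ) : finThreeToProd x = (x 0, x 1, x 2) := rfl

/-- Integration over a closed rectangle in `Fin 2 → ℝ` agrees with integration over the open
rectangle in `ℝ × ℝ`. -/
theorem setIntegral_fin_two_Icc (c d : Fin 2 → ℝ) (f : ℝ × ℝ → ℝ) :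
    ∫ x in Icc c d, f (x 0, x 1) = ∫ x in Ioo (c 0) (d 0) ×ˢ Ioo (c 1) (d 1), f x := by
  have hset : (MeasurableEquiv.finTwoArrow (α := ℝ)) ⁻¹'
      (Ioo (c 0) (d 0) ×ˢ Ioo (c 1) (d 1)) = Set.pi univ fun i => Ioo (c i) (d i) := by
    ext x
    simp only [mem_preimage, mem_prod, mem_univ_pi, Fin.forall_fin_two]
    rfl
  rw [← (volume_preserving_finTwoArrow ℝ).setIntegral_preimage_emb
    (MeasurableEquiv.measurableEmbedding _) f, hset, volume_pi,
    setIntegral_congr_set Measure.univ_pi_Ioo_ae_eq_Icc]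
  rfl

/-- A flux version of the divergence theorem on a space-time box: if the spatial flux `(A, B)`
vanishes on the lateral boundary and `∂₁A + ∂₂B + ∂ₜC = d ≥ 0`, then the spatial integral of `C`
does not decrease. -/
theorem setIntegral_le_of_divergence_nonneg {a b s t : ℝ} (ha : 0 ≤ a) (hb : 0 ≤ b) (hst : s ≤ t)
    {A B C d : ℝ × ℝ × ℝ → ℝ}
    (hA : ContinuousOn A (Icc 0 a ×ˢ Icc 0 b ×ˢ Icc s t))
    (hB : ContinuousOn B (Icc 0 a ×ˢ Icc 0 b ×ˢ Icc s t))
    (hC : ContinuousOn C (Icc 0 a ×ˢ Icc 0 b ×ˢ Icc s t))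
    (hd : ContinuousOn d (Icc 0 a ×ˢ Icc 0 b ×ˢ Icc s t))
    (hA' : ∀ p ∈ Ioo 0 a ×ˢ Ioo 0 b ×ˢ Ioo s t, DifferentiableAt ℝ A p)
    (hB' : ∀ p ∈ Ioo 0 a ×ˢ Ioo 0 b ×ˢ Ioo s t, DifferentiableAt ℝ B p)
    (hC' : ∀ p ∈ Ioo 0 a ×ˢ Ioo 0 b ×ˢ Ioo s t, DifferentiableAt ℝ C p)
    (hdiv : ∀ p ∈ Ioo 0 a ×ˢ Ioo 0 b ×ˢ Ioo s t, pd1 A p + pd2 B p + pdt C p = d p)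
    (hnonneg : ∀ p ∈ Ioo 0 a ×ˢ Ioo 0 b ×ˢ Ioo s t, 0 ≤ d p)
    (hA₀ : ∀ y ∈ Icc 0 b, ∀ r ∈ Icc s t, A (0, y, r) = 0 ∧ A (a, y, r) = 0)
    (hB₀ : ∀ x ∈ Icc 0 a, ∀ r ∈ Icc s t, B (x, 0, r) = 0 ∧ B (x, b, r) = 0) :
    ∫ x in Ioo 0 a ×ˢ Ioo 0 b, C (x.1, x.2, s) ≤ ∫ x in Ioo 0 a ×ˢ Ioo 0 b, C (x.1, x.2, t) := by
  let lo : Fin 3 → ℝ := ![0, 0, s]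
  let hi : Fin 3 → ℝ := ![a, b, t]
  let F : Fin 3 → ℝ × ℝ × ℝ → ℝ := ![A, B, C]
  have hle : lo ≤ hi := by
    intro i; fin_cases i <;> simp [lo, hi, ha, hb, hst]
  have hmaps : MapsTo finThreeToProd (Icc lo hi) (Icc 0 a ×ˢ Icc 0 b ×ˢ Icc s t) := by
    intro x hx
    exact ⟨⟨hx.1 0, hx.2 0⟩, ⟨hx.1 1, hx.2 1⟩, ⟨hx.1 2, hx.2 2⟩⟩
  have hmaps' : MapsTo finThreeToProd (Set.pi univ fun i => Ioo (lo i) (hi i))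
      (Ioo 0 a ×ˢ Ioo 0 b ×ˢ Ioo s t) := by
    intro x hx
    exact ⟨hx 0 (mem_univ _), hx 1 (mem_univ _), hx 2 (mem_univ _)⟩
  have hpi : MeasurableSet (Set.pi univ fun i => Ioo (lo i) (hi i)) :=
    MeasurableSet.univ_pi fun _ => measurableSet_Ioo
  have hae : (Set.pi univ fun i => Ioo (lo i) (hi i)) =ᵐ[volume] Icc lo hi :=
    Measure.univ_pi_Ioo_ae_eq_Icc
  have hsum : ∀ x ∈ Set.pi univ fun i => Ioo (lo i) (hi i),
      ∑ i, ((fderiv ℝ (F i) (finThreeToProd x)).comp finThreeToProd) (Pi.single i 1)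
        = d (finThreeToProd x) := by
    intro x hx
    rw [← hdiv _ (hmaps' hx)]
    simp [Fin.sum_univ_three, F, pd1, pd2, pdt, finThreeToProd_apply]
  have key := integral_divergence_of_hasFDerivAt_off_countable' lo hi hle
    (fun i x => F i (finThreeToProd x))
    (fun i x => (fderiv ℝ (F i) (finThreeToProd x)).comp finThreeToProd) ∅ countable_empty
    (by
      intro i
      refine ContinuousOn.comp (t := Icc 0 a ×ˢ Icc 0 b ×ˢ Icc s t) ?_
        finThreeToProd.continuous.continuousOn hmaps
      fin_cases i
      exacts [hA, hB, hC])
    (by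
      intro x hx i
      refine HasFDerivAt.comp x (DifferentiableAt.hasFDerivAt ?_) finThreeToProd.hasFDerivAt
      fin_cases i
      exacts [hA' _ (hmaps' hx.1), hB' _ (hmaps' hx.1), hC' _ (hmaps' hx.1)])
    (by
      refine IntegrableOn.congr_set_ae ?_ hae.symm
      refine IntegrableOn.congr_fun ?_ (fun x hx => (hsum x hx).symm) hpi
      refine IntegrableOn.congr_set_ae ?_ hae
      exact (hd.comp finThreeToProd.continuous.continuousOn hmaps).integrableOn_compact
        isCompact_Icc)
  have hpos : 0 ≤ ∫ x in Icc lo hi,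
      ∑ i, ((fderiv ℝ (F i) (finThreeToProd x)).comp finThreeToProd) (Pi.single i 1) := by
    rw [← setIntegral_congr_set hae, setIntegral_congr_fun hpi hsum]
    exact setIntegral_nonneg hpi fun x hx => hnonneg _ (hmaps' hx)
  rw [key, Fin.sum_univ_three] at hpos
  have hz : ∀ (c e : Fin 2 → ℝ) (f : (Fin 2 → ℝ) → ℝ), (∀ x ∈ Icc c e, f x = 0) →
      ∫ x in Icc c e, f x = 0 := fun c e f hf => setIntegral_eq_zero_of_forall_eq_zero hf
  rw [hz _ _ _ ?_, hz _ _ _ ?_, hz _ _ _ ?_, hz _ _ _ ?_] at hpos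
  · have h1 := setIntegral_fin_two_Icc (lo ∘ Fin.succAbove 2) (hi ∘ Fin.succAbove 2)
      (fun x => C (x.1, x.2, s))
    have h2 := setIntegral_fin_two_Icc (lo ∘ Fin.succAbove 2) (hi ∘ Fin.succAbove 2)
      (fun x => C (x.1, x.2, t))
    have h3 : ∫ x in Ioo 0 a ×ˢ Ioo 0 b, C (x.1, x.2, s) =
        ∫ x in Icc (lo ∘ Fin.succAbove 2) (hi ∘ Fin.succAbove 2),
          F 2 (finThreeToProd (Fin.insertNth 2 (lo 2) x)) := h1.symm
    have h4 : ∫ x in Ioo 0 a ×ˢ Ioo 0 b, C (x.1, x.2, t) =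
        ∫ x in Icc (lo ∘ Fin.succAbove 2) (hi ∘ Fin.succAbove 2),
          F 2 (finThreeToProd (Fin.insertNth 2 (hi 2) x)) := h2.symm
    rw [h3, h4]
    linarith
  · intro x hx
    exact (hB₀ (x 0) ⟨hx.1 0, hx.2 0⟩ (x 1) ⟨hx.1 1, hx.2 1⟩).1
  · intro x hx
    exact (hB₀ (x 0) ⟨hx.1 0, hx.2 0⟩ (x 1) ⟨hx.1 1, hx.2 1⟩).2
  · intro x hx
    exact (hA₀ (x 0) ⟨hx.1 0, hx.2 0⟩ (x 1) ⟨hx.1 1, hx.2 1⟩).1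
  · intro x hx
    exact (hA₀ (x 0) ⟨hx.1 0, hx.2 0⟩ (x 1) ⟨hx.1 1, hx.2 1⟩).2

/-- The local energy balance: the shallow water equations, with stress tensor `S`, turn the
space-time divergence of the energy flux into the dissipation `2μ S : ∇u`. -/
theorem energy_flux_divergence {ρ μ g ζ : ℝ} {η u₁ u₂ S₁₁ S₁₂ S₂₂ : ℝ × ℝ × ℝ → ℝ} {p : ℝ × ℝ × ℝ}
    (hη : DifferentiableAt ℝ η p) (hu₁ : DifferentiableAt ℝ u₁ p) (hu₂ : DifferentiableAt ℝ u₂ p)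
    (hS₁₁ : DifferentiableAt ℝ S₁₁ p) (hS₁₂ : DifferentiableAt ℝ S₁₂ p)
    (hS₂₂ : DifferentiableAt ℝ S₂₂ p)
    (hmass : pdt (fun q => η q + ζ) p + pd1 (fun q => u₁ q * (η q + ζ)) p
        + pd2 (fun q => u₂ q * (η q + ζ)) p = 0)
    (hmom₁ : ρ * (η p + ζ) * (pdt u₁ p + u₁ p * pd1 u₁ p + u₂ p * pd2 u₁ p)
        - 2 * μ * (pd1 S₁₁ p + pd2 S₁₂ p) + ρ * g * (η p + ζ) * pd1 η p = 0)
    (hmom₂ : ρ * (η p + ζ) * (pdt u₂ p + u₁ p * pd1 u₂ p + u₂ p * pd2 u₂ p)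
        - 2 * μ * (pd1 S₁₂ p + pd2 S₂₂ p) + ρ * g * (η p + ζ) * pd2 η p = 0) :
    pd1 (fun q => 2 * μ * (S₁₁ q * u₁ q + S₁₂ q * u₂ q)
          - (ρ / 2 * (u₁ q * u₁ q + u₂ q * u₂ q) + ρ * g * η q) * (u₁ q * (η q + ζ))) p
      + pd2 (fun q => 2 * μ * (S₁₂ q * u₁ q + S₂₂ q * u₂ q)
          - (ρ / 2 * (u₁ q * u₁ q + u₂ q * u₂ q) + ρ * g * η q) * (u₂ q * (η q + ζ))) p
      + pdt (fun q => -(ρ / 2 * ((η q + ζ) * (u₁ q * u₁ q + u₂ q * u₂ q))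
          + ρ * g / 2 * (η q * η q))) p
      = 2 * μ * (S₁₁ p * pd1 u₁ p + S₁₂ p * (pd2 u₁ p + pd1 u₂ p) + S₂₂ p * pd2 u₂ p) := by
  have hη := hη.hasFDerivAt
  have hu₁ := hu₁.hasFDerivAt
  have hu₂ := hu₂.hasFDerivAt
  have hφ := hη.add_const ζ
  have hm₁ := hu₁.mul hφ
  have hm₂ := hu₂.mul hφ
  have hsq := (hu₁.mul hu₁).add (hu₂.mul hu₂)
  have hpot := (hsq.const_mul (ρ / 2)).add (hη.const_mul (ρ * g))
  have hA := (((hS₁₁.hasFDerivAt.mul hu₁).add (hS₁₂.hasFDerivAt.mul hu₂)).const_mul (2 * μ)).sub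
    (hpot.mul hm₁)
  have hB := (((hS₁₂.hasFDerivAt.mul hu₁).add (hS₂₂.hasFDerivAt.mul hu₂)).const_mul (2 * μ)).sub
    (hpot.mul hm₂)
  have hC := (((hφ.mul hsq).const_mul (ρ / 2)).add ((hη.mul hη).const_mul (ρ * g / 2))).neg
  have eA := congrArg (fun L => L (1, 0, 0)) hA.fderiv
  have eB := congrArg (fun L => L (0, 1, 0)) hB.fderiv
  have eC := congrArg (fun L => L (0, 0, 1)) hC.fderiv
  have e₁ := congrArg (fun L => L (1, 0, 0)) hm₁.fderiv
  have e₂ := congrArg (fun L => L (0, 1, 0)) hm₂.fderiv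
  have e₃ := congrArg (fun L => L (0, 0, 1)) hφ.fderiv
  simp only [pd1, pd2, pdt] at hmass hmom₁ hmom₂ ⊢
  erw [e₁, e₂, e₃] at hmass
  erw [eA, eB, eC]
  simp only [add_apply, sub_apply, neg_apply, smul_apply, smul_eq_mul, Pi.add_apply,
    Pi.mul_apply] at hmass ⊢
  linear_combination (-u₁ p) * hmom₁ + (-u₂ p) * hmom₂
    - (ρ * g * η p + ρ / 2 * (u₁ p * u₁ p + u₂ p * u₂ p)) * hmass

/-- Directional derivatives of a `C²` function on a set, taken within the set, are
differentiable at interior points. -/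
theorem ContDiffOn.differentiableAt_fderivWithin_apply {E : Type*} [NormedAddCommGroup E]
    [NormedSpace ℝ E] {f : E → ℝ} {K : Set E} {p : E} (hf : ContDiffOn ℝ 2 f K)
    (hp : K ∈ nhds p) (v : E) : DifferentiableAt ℝ (fun q => fderivWithin ℝ f K q v) p := by
  have h := ((hf.contDiffAt hp).fderiv_right (m := 1) (by norm_num)).differentiableAt (by norm_num)
  refine (h.clm_apply (differentiableAt_const v)).congr_of_eventuallyEq ?_
  filter_upwards [eventually_mem_nhds_iff.2 hp] with q hq
  rw [fderivWithin_of_mem_nhds hq]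

/-- For the shallow water equations with flat bottom `ζ` and pure homogeneous
Dirichlet boundary conditions on the rectangle `Ω = (0,a) × (0,b)`, if in addition
the total height `φ = η + ζ` is nonnegative, then the total energy
`E(t) = ∫_Ω (ρ/2)φ|u|² dx + ∫_Ω (ρg/2)|η|² dx` is nonincreasing on `[0,T]`. -/
theorem stmt_11
    (a b T ρ μ g ζ : ℝ) (ha : 0 < a) (hb : 0 < b) (hT : 0 < T)
    (hρ : 0 < ρ) (hμ : 0 < μ) (hg : 0 < g) (hζ : 0 < ζ)
    (η u₁ u₂ : ℝ × ℝ × ℝ → ℝ)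
    (hη : ContDiffOn ℝ 1 η (Icc 0 a ×ˢ Icc 0 b ×ˢ Icc 0 T))
    (hu₁ : ContDiffOn ℝ 2 u₁ (Icc 0 a ×ˢ Icc 0 b ×ˢ Icc 0 T))
    (hu₂ : ContDiffOn ℝ 2 u₂ (Icc 0 a ×ˢ Icc 0 b ×ˢ Icc 0 T))
    (hmass : ∀ p ∈ Ioo 0 a ×ˢ Ioo 0 b ×ˢ Ioo 0 T,
      pdt (fun q => η q + ζ) p + pd1 (fun q => u₁ q * (η q + ζ)) p
        + pd2 (fun q => u₂ q * (η q + ζ)) p = 0)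
    (hmom₁ : ∀ p ∈ Ioo 0 a ×ˢ Ioo 0 b ×ˢ Ioo 0 T,
      ρ * (η p + ζ) * (pdt u₁ p + u₁ p * pd1 u₁ p + u₂ p * pd2 u₁ p)
        - 2 * μ * (pd1 (fun q => (η q + ζ) * D11 u₁ u₂ q) p
            + pd2 (fun q => (η q + ζ) * D12 u₁ u₂ q) p)
        + ρ * g * (η p + ζ) * pd1 η p = 0)
    (hmom₂ : ∀ p ∈ Ioo 0 a ×ˢ Ioo 0 b ×ˢ Ioo 0 T,
      ρ * (η p + ζ) * (pdt u₂ p + u₁ p * pd1 u₂ p + u₂ p * pd2 u₂ p)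
        - 2 * μ * (pd1 (fun q => (η q + ζ) * D12 u₁ u₂ q) p
            + pd2 (fun q => (η q + ζ) * D22 u₁ u₂ q) p)
        + ρ * g * (η p + ζ) * pd2 η p = 0)
    (hbc : ∀ x₁ ∈ Icc 0 a, ∀ x₂ ∈ Icc 0 b, ∀ t ∈ Icc 0 T,
      (x₁ = 0 ∨ x₁ = a ∨ x₂ = 0 ∨ x₂ = b) →
        u₁ (x₁, x₂, t) = 0 ∧ u₂ (x₁, x₂, t) = 0)
    (hφpos : ∀ p ∈ Icc 0 a ×ˢ Icc 0 b ×ˢ Icc 0 T, 0 ≤ η p + ζ) :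
    AntitoneOn (fun t : ℝ =>
      (∫ x in Ioo 0 a ×ˢ Ioo 0 b,
        ρ / 2 * (η (x.1, x.2, t) + ζ) * (u₁ (x.1, x.2, t) ^ 2 + u₂ (x.1, x.2, t) ^ 2))
      + ∫ x in Ioo 0 a ×ˢ Ioo 0 b, ρ * g / 2 * η (x.1, x.2, t) ^ 2) (Icc 0 T) := by
  set K : Set (ℝ × ℝ × ℝ) := Icc 0 a ×ˢ Icc 0 b ×ˢ Icc 0 T
  have hKu : UniqueDiffOn ℝ K := (uniqueDiffOn_Icc ha).prod
    ((uniqueDiffOn_Icc hb).prod (uniqueDiffOn_Icc hT))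
  have hKn : ∀ p ∈ Ioo 0 a ×ˢ Ioo 0 b ×ˢ Ioo 0 T, K ∈ nhds p := fun p hp =>
    prod_mem_nhds (Icc_mem_nhds hp.1.1 hp.1.2)
      (prod_mem_nhds (Icc_mem_nhds hp.2.1.1 hp.2.1.2) (Icc_mem_nhds hp.2.2.1 hp.2.2.2))
  have hcD : ∀ {f : ℝ × ℝ × ℝ → ℝ}, ContDiffOn ℝ 2 f K → ∀ v,
      ContinuousOn (fun q => fderivWithin ℝ f K q v) K := fun hf v =>
    (hf.continuousOn_fderivWithin hKu (by norm_num)).clm_apply continuousOn_const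
  let e₁ : ℝ × ℝ × ℝ := (1, 0, 0)
  let e₂ : ℝ × ℝ × ℝ := (0, 1, 0)
  -- The strain-rate tensor, with derivatives taken within the closed box.
  let W₁₁ : ℝ × ℝ × ℝ → ℝ := fun q => fderivWithin ℝ u₁ K q e₁
  let W₁₂ : ℝ × ℝ × ℝ → ℝ := fun q =>
    (fderivWithin ℝ u₁ K q e₂ + fderivWithin ℝ u₂ K q e₁) / 2
  let W₂₂ : ℝ × ℝ × ℝ → ℝ := fun q => fderivWithin ℝ u₂ K q e₂
  have hηc : ContinuousOn η K := hη.continuousOn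
  have hu₁c : ContinuousOn u₁ K := hu₁.continuousOn
  have hu₂c : ContinuousOn u₂ K := hu₂.continuousOn
  have hW₁₁ : ContinuousOn W₁₁ K := hcD hu₁ _
  have hW₁₂ : ContinuousOn W₁₂ K := ((hcD hu₁ _).add (hcD hu₂ _)).div_const 2
  have hW₂₂ : ContinuousOn W₂₂ K := hcD hu₂ _
  let S₁₁ : ℝ × ℝ × ℝ → ℝ := fun q => (η q + ζ) * W₁₁ q
  let S₁₂ : ℝ × ℝ × ℝ → ℝ := fun q => (η q + ζ) * W₁₂ q
  let S₂₂ : ℝ × ℝ × ℝ → ℝ := fun q => (η q + ζ) * W₂₂ q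
  have hS₁₁ : ContinuousOn S₁₁ K := (hηc.add continuousOn_const).mul hW₁₁
  have hS₁₂ : ContinuousOn S₁₂ K := (hηc.add continuousOn_const).mul hW₁₂
  have hS₂₂ : ContinuousOn S₂₂ K := (hηc.add continuousOn_const).mul hW₂₂
  let A : ℝ × ℝ × ℝ → ℝ := fun q => 2 * μ * (S₁₁ q * u₁ q + S₁₂ q * u₂ q)
    - (ρ / 2 * (u₁ q * u₁ q + u₂ q * u₂ q) + ρ * g * η q) * (u₁ q * (η q + ζ))
  let B : ℝ × ℝ × ℝ → ℝ := fun q => 2 * μ * (S₁₂ q * u₁ q + S₂₂ q * u₂ q)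
    - (ρ / 2 * (u₁ q * u₁ q + u₂ q * u₂ q) + ρ * g * η q) * (u₂ q * (η q + ζ))
  let C : ℝ × ℝ × ℝ → ℝ := fun q => -(ρ / 2 * ((η q + ζ) * (u₁ q * u₁ q + u₂ q * u₂ q))
    + ρ * g / 2 * (η q * η q))
  let d : ℝ × ℝ × ℝ → ℝ := fun q =>
    2 * μ * ((η q + ζ) * (W₁₁ q ^ 2 + 2 * W₁₂ q ^ 2 + W₂₂ q ^ 2))
  have hA : ContinuousOn A K := by fun_prop
  have hB : ContinuousOn B K := by fun_prop
  have hC : ContinuousOn C K := by fun_prop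
  have hd : ContinuousOn d K := by fun_prop
  have hdiff : ∀ p ∈ Ioo 0 a ×ˢ Ioo 0 b ×ˢ Ioo 0 T,
      DifferentiableAt ℝ A p ∧ DifferentiableAt ℝ B p ∧ DifferentiableAt ℝ C p ∧
        pd1 A p + pd2 B p + pdt C p = d p := by
    intro p hp
    have hpK := hKn p hp
    have dη : DifferentiableAt ℝ η p := (hη.contDiffAt hpK).differentiableAt (by norm_num)
    have du₁ : DifferentiableAt ℝ u₁ p := (hu₁.contDiffAt hpK).differentiableAt (by norm_num)
    have du₂ : DifferentiableAt ℝ u₂ p := (hu₂.contDiffAt hpK).differentiableAt (by norm_num)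
    have dφ : DifferentiableAt ℝ (fun q => η q + ζ) p := dη.add_const ζ
    have dS₁₁ : DifferentiableAt ℝ S₁₁ p :=
      dφ.mul (hu₁.differentiableAt_fderivWithin_apply hpK e₁)
    have dW₁₂ : DifferentiableAt ℝ W₁₂ p := by
      have h₁ := hu₁.differentiableAt_fderivWithin_apply hpK e₂
      have h₂ := hu₂.differentiableAt_fderivWithin_apply hpK e₁
      fun_prop
    have dS₁₂ : DifferentiableAt ℝ S₁₂ p := dφ.mul dW₁₂
    have dS₂₂ : DifferentiableAt ℝ S₂₂ p :=
      dφ.mul (hu₂.differentiableAt_fderivWithin_apply hpK e₂)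
    have hD₁₁ : (fun q => (η q + ζ) * D11 u₁ u₂ q) =ᶠ[nhds p] S₁₁ := by
      filter_upwards [eventually_mem_nhds_iff.2 hpK] with q hq
      simp only [S₁₁, W₁₁, D11, pd1, fderivWithin_of_mem_nhds hq, e₁]
    have hD₁₂ : (fun q => (η q + ζ) * D12 u₁ u₂ q) =ᶠ[nhds p] S₁₂ := by
      filter_upwards [eventually_mem_nhds_iff.2 hpK] with q hq
      simp only [S₁₂, W₁₂, D12, pd1, pd2, fderivWithin_of_mem_nhds hq, e₁, e₂]
    have hD₂₂ : (fun q => (η q + ζ) * D22 u₁ u₂ q) =ᶠ[nhds p] S₂₂ := by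
      filter_upwards [eventually_mem_nhds_iff.2 hpK] with q hq
      simp only [S₂₂, W₂₂, D22, pd2, fderivWithin_of_mem_nhds hq, e₂]
    have m₁ := hmom₁ p hp
    have m₂ := hmom₂ p hp
    simp only [pd1, pd2, hD₁₁.fderiv_eq, hD₁₂.fderiv_eq] at m₁
    simp only [pd1, pd2, hD₁₂.fderiv_eq, hD₂₂.fderiv_eq] at m₂
    refine ⟨by fun_prop, by fun_prop, by fun_prop, ?_⟩
    refine (energy_flux_divergence dη du₁ du₂ dS₁₁ dS₁₂ dS₂₂ (hmass p hp) m₁ m₂).trans ?_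
    simp only [d, S₁₁, S₁₂, S₂₂, W₁₁, W₁₂, W₂₂, pd1, pd2, fderivWithin_of_mem_nhds hpK, e₁, e₂]
    ring
  have hsplit : ∀ t ∈ Icc 0 T,
      (∫ x in Ioo 0 a ×ˢ Ioo 0 b,
        ρ / 2 * (η (x.1, x.2, t) + ζ) * (u₁ (x.1, x.2, t) ^ 2 + u₂ (x.1, x.2, t) ^ 2))
      + ∫ x in Ioo 0 a ×ˢ Ioo 0 b, ρ * g / 2 * η (x.1, x.2, t) ^ 2
      = -∫ x in Ioo 0 a ×ˢ Ioo 0 b, C (x.1, x.2, t) := by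
    intro t ht
    have hmaps : MapsTo (fun x : ℝ × ℝ => (x.1, x.2, t)) (Icc 0 a ×ˢ Icc 0 b) K :=
      fun x hx => ⟨hx.1, hx.2, ht⟩
    have hint : ∀ f : ℝ × ℝ × ℝ → ℝ, ContinuousOn f K →
        IntegrableOn (fun x : ℝ × ℝ => f (x.1, x.2, t)) (Ioo 0 a ×ˢ Ioo 0 b) := fun f hf =>
      ((hf.comp (by fun_prop) hmaps).integrableOn_compact
        (isCompact_Icc.prod isCompact_Icc)).mono_set
          (prod_mono Ioo_subset_Icc_self Ioo_subset_Icc_self)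
    rw [← integral_add
      (hint (fun q => ρ / 2 * (η q + ζ) * (u₁ q ^ 2 + u₂ q ^ 2)) (by fun_prop))
      (hint (fun q => ρ * g / 2 * η q ^ 2) (by fun_prop)), ← integral_neg]
    congr 1
    ext x
    simp only [C]
    ring
  intro s hs t ht hst
  simp only [hsplit s hs, hsplit t ht, neg_le_neg_iff]
  have hsub : Icc 0 a ×ˢ Icc 0 b ×ˢ Icc s t ⊆ K :=
    prod_mono_right (prod_mono_right (Icc_subset_Icc hs.1 ht.2))
  have hsub' : Ioo 0 a ×ˢ Ioo 0 b ×ˢ Ioo s t ⊆ Ioo 0 a ×ˢ Ioo 0 b ×ˢ Ioo 0 T :=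
    prod_mono_right (prod_mono_right (Ioo_subset_Ioo hs.1 ht.2))
  refine setIntegral_le_of_divergence_nonneg ha.le hb.le hst (hA.mono hsub) (hB.mono hsub)
    (hC.mono hsub) (hd.mono hsub) (fun p hp => (hdiff p (hsub' hp)).1)
    (fun p hp => (hdiff p (hsub' hp)).2.1) (fun p hp => (hdiff p (hsub' hp)).2.2.1)
    (fun p hp => (hdiff p (hsub' hp)).2.2.2) (fun p hp => ?_) (fun y hy r hr => ?_)
    (fun x hx r hr => ?_)
  · have := hφpos p (mem_of_mem_nhds (hKn p (hsub' hp)))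
    positivity
  · have hr' := Icc_subset_Icc hs.1 ht.2 hr
    obtain ⟨h₁, h₂⟩ := hbc 0 (left_mem_Icc.2 ha.le) y hy r hr' (by simp)
    obtain ⟨h₃, h₄⟩ := hbc a (right_mem_Icc.2 ha.le) y hy r hr' (by simp)
    simp [A, h₁, h₂, h₃, h₄]
  · have hr' := Icc_subset_Icc hs.1 ht.2 hr
    obtain ⟨h₁, h₂⟩ := hbc x hx 0 (left_mem_Icc.2 hb.le) r hr' (by simp)
    obtain ⟨h₃, h₄⟩ := hbc x hx b (right_mem_Icc.2 hb.le) r hr' (by simp)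
    simp [B, h₁, h₂, h₃, h₄]
end
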